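/- arXiv:1409.8390 — 2 statements merged into one kernel-verified Lean document; each statement's English description precedes it below -/
import Mathlib

section
/- Let G be a finite group, k ≥ 1, and T₁ ⊆ T₂ ⊆ … ⊆ T_k subsets of G; set G_i = ⟨T_i⟩ and assume each G_i is nontrivial. Then there exist subsets A₁ ⊆ A₂ ⊆ … ⊆ A_k of G such that for each i: |A_i| ≤ log |G_i|, ⟨A_i⟩ = G_i, some SLP over T_i of reduced length less than (log |G_i|)² computes A_i, and every g ∈ G_i is computed by some SLP over A_i of reduced length less than 2·log |G_i|. -/
/-- `log₂ m` is the least natural number `r` with `2 ^ r ≥ m`. -/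
noncomputable def log₂ (m : ℕ) : ℕ := sInf {r : ℕ | m ≤ 2 ^ r}

/-- A straight line program (SLP) over a subset `S` of a group `G` is a finite
sequence `y 0, …, y (n-1)` of elements of `G` in which each `y i` either lies
in `S`, or is the inverse of an earlier element, or the product of two earlier
elements. -/
def IsSLP {G : Type*} [Group G] (S : Set G) {n : ℕ} (y : Fin n → G) : Prop :=
  ∀ i : Fin n, y i ∈ S ∨ (∃ j, j < i ∧ y i = (y j)⁻¹) ∨
    ∃ j k, j < i ∧ k < i ∧ y i = y j * y k

/-- The reduced length of an SLP is the number of indices `i` with `y i ∉ S`. -/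
noncomputable def reducedLength {G : Type*} (S : Set G) {n : ℕ} (y : Fin n → G) : ℕ :=
  Nat.card {i : Fin n // y i ∉ S}

open Classical in
theorem reducedLength_eq_sum {G : Type*} (S : Set G) {n : ℕ} (y : Fin n → G) :
    reducedLength S y = ∑ i, if y i ∈ S then 0 else 1 := by
  rw [reducedLength, Nat.card_eq_fintype_card, Fintype.card_subtype, Finset.card_filter]
  exact Finset.sum_congr rfl fun i _ => by split_ifs <;> simp_all

open Classical in
theorem reducedLength_snoc {G : Type*} (S : Set G) {n : ℕ} (y : Fin n → G) (x : G) :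
    reducedLength S (Fin.snoc y x : Fin (n + 1) → G) =
      reducedLength S y + if x ∈ S then 0 else 1 := by
  rw [reducedLength_eq_sum, reducedLength_eq_sum, Fin.sum_univ_castSucc]
  refine congrArg₂ (· + ·) (Finset.sum_congr rfl fun i _ => ?_) ?_
  · rw [Fin.snoc_castSucc]
  · rw [Fin.snoc_last]

theorem reducedLength_snoc_le {G : Type*} (S : Set G) {n : ℕ} (y : Fin n → G) (x : G) :
    reducedLength S (Fin.snoc y x : Fin (n + 1) → G) ≤ reducedLength S y + 1 := by
  rw [reducedLength_snoc]
  split_ifs <;> omega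

theorem reducedLength_snoc_of_mem {G : Type*} {S : Set G} {n : ℕ} (y : Fin n → G) {x : G} (hx : x ∈ S) :
    reducedLength S (Fin.snoc y x : Fin (n + 1) → G) = reducedLength S y := by
  rw [reducedLength_snoc, if_pos hx, add_zero]

theorem range_snoc {G : Type*} {n : ℕ} (y : Fin n → G) (x : G) :
    Set.range (Fin.snoc y x : Fin (n + 1) → G) = insert x (Set.range y) := by
  ext g
  simp [eq_comm]

open Pointwise in
/-- The cube of a list `z₁, …, z_r`: all products `z₁ ^ e₁ * ⋯ * z_r ^ e_r` with exponents
`0` or `1`. -/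
def cube {G : Type*} [Group G] : List G → Set G
  | [] => {1}
  | x :: z => cube z ∪ x • cube z

/-- `Computes S l n`: reading `l` from its end to its head gives an SLP over `S` in which at
most `n` steps are inversions or multiplications. -/
inductive Computes {G : Type*} [Group G] (S : Set G) : List G → ℕ → Prop
  | nil : Computes S [] 0
  | mem {l : List G} {n : ℕ} {x : G} (h : Computes S l n) (hx : x ∈ S) : Computes S (x :: l) n
  | inv {l : List G} {n : ℕ} {x : G} (h : Computes S l n) (hx : x ∈ l) :
      Computes S (x⁻¹ :: l) (n + 1)
  | mul {l : List G} {n : ℕ} {x y : G} (h : Computes S l n) (hx : x ∈ l) (hy : y ∈ l) :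
      Computes S (x * y :: l) (n + 1)

section

variable {G : Type*} [Group G]

theorem IsSLP.snoc {S : Set G} {n : ℕ} {y : Fin n → G} (h : IsSLP S y) {x : G}
    (hx : x ∈ S ∨ (∃ j, x = (y j)⁻¹) ∨ ∃ j k, x = y j * y k) :
    IsSLP S (Fin.snoc y x : Fin (n + 1) → G) := by
  intro i
  induction i using Fin.lastCases with
  | last =>
    rcases hx with hx | ⟨j, hj⟩ | ⟨j, k, hjk⟩
    · exact Or.inl (by simpa using hx)
    · exact Or.inr (Or.inl ⟨j.castSucc, Fin.castSucc_lt_last j, by simpa using hj⟩)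
    · exact Or.inr (Or.inr ⟨j.castSucc, k.castSucc, Fin.castSucc_lt_last j,
        Fin.castSucc_lt_last k, by simpa using hjk⟩)
  | cast i =>
    rcases h i with hi | ⟨j, hj, e⟩ | ⟨j, k, hj, hk, e⟩
    · exact Or.inl (by simpa using hi)
    · exact Or.inr (Or.inl ⟨j.castSucc, Fin.castSucc_lt_castSucc_iff.2 hj, by simpa using e⟩)
    · exact Or.inr (Or.inr ⟨j.castSucc, k.castSucc, Fin.castSucc_lt_castSucc_iff.2 hj,
        Fin.castSucc_lt_castSucc_iff.2 hk, by simpa using e⟩)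

namespace Computes

variable {S S' : Set G} {l : List G} {n : ℕ}

theorem mono (h : Computes S l n) (hS : S ⊆ S') : Computes S' l n := by
  induction h with
  | nil => exact nil
  | mem _ hx ih => exact ih.mem (hS hx)
  | inv _ hx ih => exact ih.inv hx
  | mul _ hx hy ih => exact ih.mul hx hy

theorem exists_isSLP (h : Computes S l n) : ∃ (m : ℕ) (y : Fin m → G), IsSLP S y ∧
    reducedLength S y ≤ n ∧ Set.range y = {x | x ∈ l} := by
  induction h with
  | nil => exact ⟨0, Fin.elim0, fun i => i.elim0, by simp [reducedLength], by simp⟩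
  | @mem l n x _ hx ih =>
    obtain ⟨m, y, hy, hn, hr⟩ := ih
    refine ⟨m + 1, Fin.snoc y x, hy.snoc (Or.inl hx), ?_, ?_⟩
    · rwa [reducedLength_snoc_of_mem y hx]
    · rw [range_snoc, hr]; ext; simp
  | @inv l n x _ hx ih =>
    obtain ⟨m, y, hy, hn, hr⟩ := ih
    obtain ⟨j, rfl⟩ : x ∈ Set.range y := hr ▸ hx
    refine ⟨m + 1, Fin.snoc y (y j)⁻¹, hy.snoc (Or.inr (Or.inl ⟨j, rfl⟩)),
      (reducedLength_snoc_le S y _).trans (by omega), ?_⟩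
    rw [range_snoc, hr]; ext; simp
  | @mul l n x x' _ hx hx' ih =>
    obtain ⟨m, y, hy, hn, hr⟩ := ih
    obtain ⟨j, rfl⟩ : x ∈ Set.range y := hr ▸ hx
    obtain ⟨k, rfl⟩ : x' ∈ Set.range y := hr ▸ hx'
    refine ⟨m + 1, Fin.snoc y (y j * y k), hy.snoc (Or.inr (Or.inr ⟨j, k, rfl⟩)),
      (reducedLength_snoc_le S y _).trans (by omega), ?_⟩
    rw [range_snoc, hr]; ext; simp

theorem of_forall_mem : ∀ l : List G, (∀ x ∈ l, x ∈ S) → Computes S l 0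
  | [], _ => nil
  | x :: l, h => (of_forall_mem l fun y hy => h y (by simp [hy])).mem (h x (by simp))

theorem exists_prod_mem (h : Computes S l n) : ∀ w : List G, w ≠ [] → w ⊆ l →
    ∃ l', l ⊆ l' ∧ w.prod ∈ l' ∧ Computes S l' (n + (w.length - 1))
  | [], hw, _ => absurd rfl hw
  | [x], _, hl => ⟨l, fun _ => id, by simpa using hl, by simpa using h⟩
  | x :: y :: w, _, hl => by
    obtain ⟨l', hl', hp, hc⟩ := h.exists_prod_mem (y :: w) (by simp) fun a ha => hl (by simp_all)
    refine ⟨x * (y :: w).prod :: l', fun a ha => by simp [hl' ha], by simp, ?_⟩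
    simpa [add_assoc] using hc.mul (hl' (hl (by simp : x ∈ x :: y :: w))) hp

theorem exists_div_mem (h : Computes S l n) {w₁ w₂ : List G} (h₁ : w₁ ⊆ l) (h₂ : w₂ ⊆ l)
    (hne : w₁.prod * w₂.prod⁻¹ ≠ 1) :
    ∃ l' m, l ⊆ l' ∧ w₁.prod * w₂.prod⁻¹ ∈ l' ∧ Computes S l' m ∧
      m ≤ n + (w₁.length + w₂.length) := by
  rcases eq_or_ne w₂ [] with rfl | hw₂
  · have hw₁ : w₁ ≠ [] := by rintro rfl; simp at hne
    obtain ⟨l', hl', hp, hc⟩ := h.exists_prod_mem w₁ hw₁ h₁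
    exact ⟨l', _, hl', by simpa using hp, hc, by simp⟩
  have len₂ := List.length_pos_iff.2 hw₂
  obtain ⟨l', hl', hp, hc⟩ := h.exists_prod_mem w₂ hw₂ h₂
  rcases eq_or_ne w₁ [] with rfl | hw₁
  · exact ⟨_, _, fun a ha => by simp [hl' ha], by simp, hc.inv hp, by simp; omega⟩
  have len₁ := List.length_pos_iff.2 hw₁
  obtain ⟨l'', hl'', hp', hc'⟩ := (hc.inv hp).exists_prod_mem w₁ hw₁
    fun a ha => by simp [hl' (h₁ ha)]
  exact ⟨_, _, fun a ha => List.mem_cons_of_mem _ (hl'' (by simp [hl' ha])), by simp,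
    hc'.mul hp' (hl'' (by simp : w₂.prod⁻¹ ∈ _)), by omega⟩

end Computes

theorem exists_sublist_of_mem_cube : ∀ {z : List G} {a : G}, a ∈ cube z →
    ∃ w : List G, w.Sublist z ∧ w.prod = a
  | [], a, h => ⟨[], List.Sublist.refl _, by simpa [cube, eq_comm] using h⟩
  | x :: z, a, h => by
    rcases h with h | ⟨b, h, rfl⟩
    · obtain ⟨w, hw, rfl⟩ := exists_sublist_of_mem_cube h
      exact ⟨w, hw.cons x, rfl⟩
    · obtain ⟨w, hw, rfl⟩ := exists_sublist_of_mem_cube h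
      exact ⟨x :: w, hw.cons_cons x, by simp⟩

theorem one_mem_cube : ∀ z : List G, (1 : G) ∈ cube z
  | [] => rfl
  | _ :: z => Or.inl (one_mem_cube z)

theorem mem_of_mem_cube {H : Subgroup G} {z : List G} (hz : ∀ x ∈ z, x ∈ H) {a : G}
    (ha : a ∈ cube z) : a ∈ H := by
  obtain ⟨w, hw, rfl⟩ := exists_sublist_of_mem_cube ha
  exact H.list_prod_mem fun x hx => hz x (hw.subset hx)

open Pointwise in
theorem ncard_cube_cons [Finite G] {z : List G} {x : G}
    (hx : ∀ a ∈ cube z, ∀ b ∈ cube z, x ≠ a * b⁻¹) :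
    (cube (x :: z)).ncard = 2 * (cube z).ncard := by
  rw [cube, Set.ncard_union_eq, Set.ncard_smul_set, two_mul]
  rw [Set.disjoint_left]
  rintro _ ha ⟨b, hb, rfl⟩
  exact hx _ ha b hb (by simp)

/-- A list inside `⟨S⟩` whose cube has no coincidences, and which can be computed from `S`
with few inversions and multiplications. -/
structure IsCubeBasis (S : Set G) (z : List G) : Prop where
  mem_closure : ∀ x ∈ z, x ∈ Subgroup.closure S
  ncard_cube : (cube z).ncard = 2 ^ z.length
  computes : ∃ l n, Computes S l n ∧ z ⊆ l ∧ n ≤ z.length ^ 2 - 1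

/-- Every element of `⟨S⟩` is a right quotient of two elements of the cube of `z`. -/
def CubeFills (S : Set G) (z : List G) : Prop :=
  ∀ g ∈ Subgroup.closure S, ∃ a ∈ cube z, ∃ b ∈ cube z, g = a * b⁻¹

namespace IsCubeBasis

variable {S S' : Set G} {z : List G}

theorem nil (S : Set G) : IsCubeBasis S [] :=
  ⟨by simp, by simp [cube], [], 0, .nil, by simp, by simp⟩

theorem mono (h : IsCubeBasis S z) (hS : S ⊆ S') : IsCubeBasis S' z :=
  ⟨fun x hx => Subgroup.closure_mono hS (h.mem_closure x hx), h.ncard_cube,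
    let ⟨l, n, hc, hl, hn⟩ := h.computes; ⟨l, n, hc.mono hS, hl, hn⟩⟩

theorem two_pow_length_le [Finite G] (h : IsCubeBasis S z) :
    2 ^ z.length ≤ Nat.card (Subgroup.closure S) := by
  rw [← h.ncard_cube]
  exact Set.ncard_le_ncard (t := (Subgroup.closure S : Set G))
    (fun a ha => mem_of_mem_cube h.mem_closure ha) (Set.toFinite _)

/-- If left multiplication by `S` preserves the right quotients of the cube of `z`, then these
quotients fill `⟨S⟩`. -/
theorem cubeFills_of_mul [Finite G]
    (h : ∀ t ∈ S, ∀ a ∈ cube z, ∀ b ∈ cube z, ∃ c ∈ cube z, ∃ d ∈ cube z,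
      t * (a * b⁻¹) = c * d⁻¹) : CubeFills S z := by
  intro g hg
  rw [← Subgroup.mem_toSubmonoid, Subgroup.closure_toSubmonoid_of_finite] at hg
  induction hg using Submonoid.closure_induction_left with
  | one => exact ⟨1, one_mem_cube z, 1, one_mem_cube z, by simp⟩
  | mul_left t ht g _ ih =>
    obtain ⟨a, ha, b, hb, rfl⟩ := ih
    exact h t ht a ha b hb

theorem exists_cons [Finite G] (h : IsCubeBasis S z) (hz : ¬ CubeFills S z) :
    ∃ x, IsCubeBasis S (x :: z) := by
  have hmul := mt cubeFills_of_mul hz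
  push Not at hmul
  obtain ⟨t, ht, a, ha, b, hb, hne⟩ := hmul
  have htS := Subgroup.subset_closure ht
  refine ⟨t * (a * b⁻¹), ?_, ?_, ?_⟩
  · intro x hx
    rcases List.mem_cons.1 hx with rfl | hx
    · exact mul_mem htS (mul_mem (mem_of_mem_cube h.mem_closure ha)
        (inv_mem (mem_of_mem_cube h.mem_closure hb)))
    · exact h.mem_closure x hx
  · rw [ncard_cube_cons hne, h.ncard_cube, List.length_cons, pow_succ']
  · obtain ⟨l, n, hc, hl, hn⟩ := h.computes
    rcases eq_or_ne (a * b⁻¹) 1 with hab | hab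
    · refine ⟨t :: l, n, hc.mem ht, ?_, ?_⟩
      · rw [hab, mul_one]; exact List.cons_subset_cons t hl
      · refine hn.trans (Nat.sub_le_sub_right (Nat.pow_le_pow_left ?_ 2) 1); simp
    · obtain ⟨w₁, hw₁, rfl⟩ := exists_sublist_of_mem_cube ha
      obtain ⟨w₂, hw₂, rfl⟩ := exists_sublist_of_mem_cube hb
      obtain ⟨l', m, hl', hg, hc', hm⟩ := hc.exists_div_mem
        (fun _ hx => hl (hw₁.subset hx)) (fun _ hx => hl (hw₂.subset hx)) hab
      refine ⟨_, _, (hc'.mem ht).mul (by simp : t ∈ _) (List.mem_cons_of_mem _ hg),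
        List.cons_subset_cons _ fun x hx => List.mem_cons_of_mem _ (hl' (hl hx)), ?_⟩
      have hlen : 0 < z.length := by
        rw [List.length_pos_iff]
        rintro rfl
        simp_all
      have := hw₁.length_le
      have := hw₂.length_le
      have : 0 < z.length ^ 2 := by positivity
      have : (z.length + 1) ^ 2 = z.length ^ 2 + 2 * z.length + 1 := by ring
      rw [List.length_cons]
      omega

theorem exists_cubeFills [Finite G] {S : Set G} {z : List G} (h : IsCubeBasis S z) :
    ∃ z', z ⊆ z' ∧ IsCubeBasis S z' ∧ CubeFills S z' := by
  by_cases hz : CubeFills S z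
  · exact ⟨z, fun _ => id, h, hz⟩
  · obtain ⟨x, hx⟩ := h.exists_cons hz
    obtain ⟨z', hz', h'⟩ := hx.exists_cubeFills
    exact ⟨z', fun a ha => hz' (List.mem_cons_of_mem x ha), h'⟩
termination_by Nat.card (Subgroup.closure S) - z.length
decreasing_by
  have := hx.two_pow_length_le
  have := (x :: z).length.lt_two_pow_self
  simp only [List.length_cons] at *
  omega

theorem exists_chain [Finite G] {T : ℕ → Set G} (hT : Monotone T) :
    ∃ Z : ℕ → List G, (Monotone fun i => {x | x ∈ Z i}) ∧
      ∀ i, IsCubeBasis (T i) (Z i) ∧ CubeFills (T i) (Z i) := by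
  have key : ∀ (S : Set G) (z : List G), ∃ z', IsCubeBasis S z →
      z ⊆ z' ∧ IsCubeBasis S z' ∧ CubeFills S z' := fun S z => by
    by_cases h : IsCubeBasis S z
    · obtain ⟨z', hz'⟩ := h.exists_cubeFills
      exact ⟨z', fun _ => hz'⟩
    · exact ⟨z, fun h' => absurd h' h⟩
  choose f hf using key
  let Z : ℕ → List G := fun i => i.rec (f (T 0) []) fun i z => f (T (i + 1)) z
  have hZ : ∀ i, IsCubeBasis (T i) (Z i) ∧ CubeFills (T i) (Z i) := fun i => by
    induction i with
    | zero => exact (hf _ _ (nil _)).2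
    | succ i ih => exact (hf _ _ (ih.1.mono (hT i.le_succ))).2
  exact ⟨Z, monotone_nat_of_le_succ fun i x hx =>
    (hf _ _ ((hZ i).1.mono (hT i.le_succ))).1 hx, hZ⟩

end IsCubeBasis

theorem CubeFills.closure_eq {S : Set G} {z : List G} (h : CubeFills S z)
    (hz : IsCubeBasis S z) : Subgroup.closure {x | x ∈ z} = Subgroup.closure S := by
  refine le_antisymm ((Subgroup.closure_le _).2 hz.mem_closure) fun g hg => ?_
  obtain ⟨a, ha, b, hb, rfl⟩ := h g hg
  have hz' : ∀ x ∈ z, x ∈ Subgroup.closure {x | x ∈ z} :=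
    fun x hx => Subgroup.subset_closure hx
  exact mul_mem (mem_of_mem_cube hz' ha) (inv_mem (mem_of_mem_cube hz' hb))

theorem le_two_pow_log₂ (m : ℕ) : m ≤ 2 ^ log₂ m :=
  Nat.sInf_mem (s := {r : ℕ | m ≤ 2 ^ r}) ⟨m, m.lt_two_pow_self.le⟩

/-- The identity of a nontrivial group is computed from any of its elements with few steps. -/
theorem exists_computes_one {H : Subgroup G} [Finite H] (hH : H ≠ ⊥) {A : Set G} {x : G}
    (hx : x ∈ A) (hxH : x ∈ H) :
    ∃ l n, Computes A l n ∧ n < 2 * log₂ (Nat.card H) ∧ (1 : G) ∈ l := by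
  have h1 : Computes A [x] 0 := .of_forall_mem _ (by simpa using hx)
  have hcard : 1 < Nat.card H := by
    rw [Finite.one_lt_card_iff_nontrivial]
    exact (Subgroup.nontrivial_iff_ne_bot H).2 hH
  have hlog := le_two_pow_log₂ (Nat.card H)
  rcases Nat.lt_or_ge (log₂ (Nat.card H)) 2 with h2 | h2
  · have hle : 2 ^ log₂ (Nat.card H) ≤ 2 ^ 1 := Nat.pow_le_pow_right (by simp) (by omega)
    have hpos : log₂ (Nat.card H) ≠ 0 := fun h0 => by rw [h0] at hlog; omega
    have h3 : Nat.card H = 2 := by omega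
    have h4 : x * x = 1 := by
      have := pow_card_eq_one' (x := (⟨x, hxH⟩ : H))
      rw [h3, pow_two] at this
      simpa using congrArg Subtype.val this
    exact ⟨_, _, h1.mul (List.mem_singleton_self x) (List.mem_singleton_self x), by omega,
      by simp [h4]⟩
  · exact ⟨_, _, (h1.inv (List.mem_singleton_self x)).mul (x := x) (y := x⁻¹) (by simp) (by simp),
      by omega, by simp⟩

theorem CubeFills.exists_computes [Finite G] {S : Set G} {z : List G} (h : CubeFills S z)
    (hz : IsCubeBasis S z) (hS : Subgroup.closure S ≠ ⊥)
    (hlen : z.length ≤ log₂ (Nat.card (Subgroup.closure S))) {g : G}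
    (hg : g ∈ Subgroup.closure S) :
    ∃ l n, Computes {x | x ∈ z} l n ∧ n < 2 * log₂ (Nat.card (Subgroup.closure S)) ∧ g ∈ l := by
  rcases eq_or_ne g 1 with rfl | hg1
  · obtain ⟨x, hx⟩ : ∃ x, x ∈ z := by
      refine List.exists_mem_of_ne_nil z ?_
      rintro rfl
      exact hS ((h.closure_eq hz).symm.trans (by simp))
    exact exists_computes_one hS hx (hz.mem_closure x hx)
  · obtain ⟨a, ha, b, hb, rfl⟩ := h g hg
    obtain ⟨w₁, hw₁, rfl⟩ := exists_sublist_of_mem_cube ha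
    obtain ⟨w₂, hw₂, rfl⟩ := exists_sublist_of_mem_cube hb
    have hc : Computes {x | x ∈ z} z 0 := .of_forall_mem z fun _ => id
    obtain ⟨l, m, -, hgl, hcl, hm⟩ := hc.exists_div_mem hw₁.subset hw₂.subset hg1
    refine ⟨l, m, hcl, ?_, hgl⟩
    have h1 := hw₁.length_le
    have h2 := hw₂.length_le
    have : ¬ (w₁.length = z.length ∧ w₂.length = z.length) := fun ⟨e₁, e₂⟩ =>
      hg1 (by rw [hw₁.eq_of_length e₁, hw₂.eq_of_length e₂, mul_inv_cancel])
    omega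

end

/-- For an ascending chain `T₁ ⊆ … ⊆ T_k` of subsets of a
finite group `G` with each `G_i = ⟨T_i⟩` nontrivial, there is an ascending
chain of pre-processing sets `A₁ ⊆ … ⊆ A_k` with `|A_i| ≤ log |G_i|`,
`⟨A_i⟩ = G_i`, each `A_i` computed from `T_i` by an SLP of reduced length
`< (log |G_i|)²`, and every `g ∈ G_i` computed from `A_i` by an SLP of
reduced length `< 2 log |G_i|`. -/
theorem preprocessing_sets_ascending_chain
    {G : Type*} [Group G] [Finite G] (k : ℕ) (hk : 1 ≤ k)
    (T : Fin k → Set G) (hT : Monotone T)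
    (hnt : ∀ i, Subgroup.closure (T i) ≠ ⊥) :
    ∃ A : Fin k → Set G, Monotone A ∧
      ∀ i : Fin k,
        (A i).ncard ≤ log₂ (Nat.card ↥(Subgroup.closure (T i))) ∧
        Subgroup.closure (A i) = Subgroup.closure (T i) ∧
        (∃ (n : ℕ) (y : Fin n → G), IsSLP (T i) y ∧
          reducedLength (T i) y < (log₂ (Nat.card ↥(Subgroup.closure (T i)))) ^ 2 ∧
          A i ⊆ Set.range y) ∧
        ∀ g ∈ Subgroup.closure (T i), ∃ (n : ℕ) (y : Fin n → G), IsSLP (A i) y ∧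
          reducedLength (A i) y < 2 * log₂ (Nat.card ↥(Subgroup.closure (T i))) ∧
          g ∈ Set.range y := by
  let T' : ℕ → Set G := fun i => T ⟨min i (k - 1), by omega⟩
  have hT' : Monotone T' := fun i j hij => hT (Fin.mk_le_mk.2 (min_le_min_right _ hij))
  have hTT' : ∀ i : Fin k, T' i = T i := fun i =>
    congrArg T (Fin.ext (min_eq_left (Nat.le_sub_one_of_lt i.2)))
  obtain ⟨Z, hmono, hZ⟩ := IsCubeBasis.exists_chain hT'
  refine ⟨fun i => {x | x ∈ Z i}, fun i j hij => hmono hij, fun i => ?_⟩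
  obtain ⟨hb, hf⟩ := hZ i
  rw [hTT'] at hb hf
  have hlog := le_two_pow_log₂ (Nat.card (Subgroup.closure (T i)))
  have hlen : (Z i).length ≤ log₂ (Nat.card (Subgroup.closure (T i))) :=
    (Nat.pow_le_pow_iff_right (by norm_num)).1 (hb.two_pow_length_le.trans hlog)
  have hpos : 0 < log₂ (Nat.card (Subgroup.closure (T i))) := by
    rw [Nat.pos_iff_ne_zero]
    intro h0
    rw [h0, pow_zero] at hlog
    exact hnt i (Subgroup.eq_bot_of_card_le _ hlog)
  refine ⟨?_, hf.closure_eq hb, ?_, fun g hg => ?_⟩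
  · classical
    change {x | x ∈ Z i}.ncard ≤ _
    rw [← List.coe_toFinset, Set.ncard_coe_finset]
    exact (List.toFinset_card_le _).trans hlen
  · obtain ⟨l, n, hc, hl, hn⟩ := hb.computes
    obtain ⟨m, y, hy, hr, hrange⟩ := hc.exists_isSLP
    refine ⟨m, y, hy, ?_, ?_⟩
    · have := Nat.pow_le_pow_left hlen 2
      have : 0 < log₂ (Nat.card (Subgroup.closure (T i))) ^ 2 := by positivity
      omega
    · rw [hrange]
      exact fun x hx => hl hx
  · obtain ⟨l, n, hc, hn, hgl⟩ := hf.exists_computes hb (hnt i) hlen hg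
    obtain ⟨m, y, hy, hr, hrange⟩ := hc.exists_isSLP
    exact ⟨m, y, hy, hr.trans_lt hn, hrange ▸ hgl⟩
end

section
/- Let N and H be groups, k a natural number, s : Fin k → H a family whose range generates H, and let (E₁, ι₁, π₁, t₁) and (E₂, ι₂, π₂, t₂) be extension data for (N, H, s) inducing the same action. Then for every relator w and all a₁, a₂ ∈ N satisfying lift t₁ w = ι₁ a₁ and lift t₂ w = ι₂ a₂, the element a₁ * a₂⁻¹ lies in the center of N. -/
/-- An extension datum for `(N, H, s)`: a group `E`, an injective
homomorphism `ι : N →* E` with normal range, a surjective homomorphism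
`π : E →* H` with kernel equal to the range of `ι`, and lifts `t i` of the
generators `s i`. -/
def IsExtensionDatum {N H E : Type*} [Group N] [Group H] [Group E]
    {k : ℕ} (s : Fin k → H) (ι : N →* E) (π : E →* H) (t : Fin k → E) : Prop :=
  Function.Injective ι ∧ ι.range.Normal ∧ Function.Surjective π ∧
    π.ker = ι.range ∧ ∀ i, π (t i) = s i

/-- Two extension data induce the same action on `N`. -/
def SameAction {N E₁ E₂ : Type*} [Group N] [Group E₁] [Group E₂] {k : ℕ}
    (ι₁ : N →* E₁) (t₁ : Fin k → E₁) (ι₂ : N →* E₂) (t₂ : Fin k → E₂) : Prop :=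
  ∀ (a : N) (i : Fin k), ∃ b : N,
    t₁ i * ι₁ a * (t₁ i)⁻¹ = ι₁ b ∧ t₂ i * ι₂ a * (t₂ i)⁻¹ = ι₂ b

/-- If two extension data induce the same action, then every word acts on `N` in the same way
through either family of lifts. -/
theorem SameAction.lift {N E₁ E₂ : Type*} [Group N] [Group E₁] [Group E₂] {k : ℕ}
    {ι₁ : N →* E₁} {t₁ : Fin k → E₁} {ι₂ : N →* E₂} {t₂ : Fin k → E₂}
    (hact : SameAction ι₁ t₁ ι₂ t₂) (hinj : Function.Injective ι₁) (hnorm : ι₁.range.Normal)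
    (w : FreeGroup (Fin k)) (a : N) :
    ∃ b : N, FreeGroup.lift t₁ w * ι₁ a * (FreeGroup.lift t₁ w)⁻¹ = ι₁ b ∧
      FreeGroup.lift t₂ w * ι₂ a * (FreeGroup.lift t₂ w)⁻¹ = ι₂ b := by
  induction w using FreeGroup.induction_on generalizing a with
  | C1 => exact ⟨a, by simp, by simp⟩
  | of i => simpa using hact a i
  | inv_of i _ =>
    obtain ⟨c, hc⟩ := hnorm.conj_mem (ι₁ a) ⟨a, rfl⟩ (t₁ i)⁻¹
    obtain ⟨b, hb₁, hb₂⟩ := hact c i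
    have hba : b = a := hinj (by rw [← hb₁, hc]; group)
    subst hba
    refine ⟨c, by simpa using hc.symm, ?_⟩
    rw [← hb₂, map_inv, FreeGroup.lift_apply_of]
    group
  | mul x y hx hy =>
    obtain ⟨b, hb₁, hb₂⟩ := hy a
    obtain ⟨c, hc₁, hc₂⟩ := hx b
    refine ⟨c, ?_, ?_⟩
    · rw [← hc₁, ← hb₁, map_mul]; group
    · rw [← hc₂, ← hb₂, map_mul]; group

/-- For two extension data of `N` by `H` inducing the same
action, the values of the two lifts on a relator differ by an element of the
center of `N`. -/
theorem relator_values_differ_by_central_element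
    {N H E₁ E₂ : Type*} [Group N] [Group H] [Group E₁] [Group E₂]
    {k : ℕ} (s : Fin k → H) (hs : Subgroup.closure (Set.range s) = ⊤)
    (ι₁ : N →* E₁) (π₁ : E₁ →* H) (t₁ : Fin k → E₁)
    (ι₂ : N →* E₂) (π₂ : E₂ →* H) (t₂ : Fin k → E₂)
    (h₁ : IsExtensionDatum s ι₁ π₁ t₁) (h₂ : IsExtensionDatum s ι₂ π₂ t₂)
    (hact : SameAction ι₁ t₁ ι₂ t₂)
    (w : FreeGroup (Fin k)) (hw : FreeGroup.lift s w = 1)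
    (a₁ a₂ : N)
    (ha₁ : FreeGroup.lift t₁ w = ι₁ a₁) (ha₂ : FreeGroup.lift t₂ w = ι₂ a₂) :
    a₁ * a₂⁻¹ ∈ Subgroup.center N := by
  rw [Subgroup.mem_center_iff]
  intro g
  obtain ⟨b, hb₁, hb₂⟩ := hact.lift h₁.1 h₁.2.1 w (a₂⁻¹ * g * a₂)
  rw [ha₁, ← map_mul, ← map_inv, ← map_mul] at hb₁
  rw [ha₂, ← map_mul, ← map_inv, ← map_mul] at hb₂
  have hg : a₁ * (a₂⁻¹ * g * a₂) * a₁⁻¹ = g := by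
    rw [h₁.1 hb₁, ← h₂.1 hb₂]; group
  calc g * (a₁ * a₂⁻¹) = a₁ * (a₂⁻¹ * g * a₂) * a₁⁻¹ * (a₁ * a₂⁻¹) := by rw [hg]
    _ = a₁ * a₂⁻¹ * g := by group
end
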